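/- Let m be a positive integer and c_0 a real constant. There is no smooth function f on a nonempty open interval I with f'(t) ≠ 0 and f''(t) ≠ 0 for all t ∈ I satisfying both f''(t) = (c_0/(2m)) ((f'(t))^{(2m-2)/(2m-1)} + 2 (f'(t))^2) and (2m-2) f''(t)/(f'(t))^2 − (2m-1) f'''(t)/(f'(t) f''(t)) = 2c_0 for all t ∈ I. (Indeed, the two equations force c_0 = 0 and hence f'' ≡ 0, a contradiction.) -/

import Mathlib

/-- The real `(2m-1)`-th root of `y`: the unique real number `s` with `s^(2m-1) = y`.
For `y ≠ 0`, the fractional power `y^(p/(2m-1))` is interpreted as `(oddRoot m y)^p`. -/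
noncomputable def oddRoot (m : ℕ) (y : ℝ) : ℝ :=
  Real.sign y * |y| ^ ((2 * (m : ℝ) - 1)⁻¹)

/-- On nonzero reals, the even power `(oddRoot m y)^(2m-2)` is `|y|^((2m-2)/(2m-1))`. -/
theorem oddRoot_pow_eq_exp (m : ℕ) (hm : 1 ≤ m) {y : ℝ} (hy : y ≠ 0) :
    oddRoot m y ^ (2 * m - 2)
      = Real.exp ((2 * (m : ℝ) - 2) / (2 * (m : ℝ) - 1) * Real.log y) := by
  have he : Even (2 * m - 2) := ⟨m - 1, by omega⟩
  have hsign : |Real.sign y| = 1 := by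
    rcases Real.sign_apply_eq_of_ne_zero y hy with h | h <;> simp [h]
  have hcast : ((2 * m - 2 : ℕ) : ℝ) = 2 * (m : ℝ) - 2 := by
    rw [Nat.cast_sub (by omega)]
    push_cast
    ring
  have hy' : 0 < |y| := abs_pos.mpr hy
  rw [← he.pow_abs, oddRoot, abs_mul, hsign, one_mul, abs_of_nonneg (by positivity),
    Real.rpow_def_of_pos hy', Real.log_abs, ← Real.exp_nat_mul, hcast]
  congr 1
  ring

theorem hasDerivAt_oddRoot_pow (m : ℕ) (hm : 1 ≤ m) {y : ℝ} (hy : y ≠ 0) :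
    HasDerivAt (fun x => oddRoot m x ^ (2 * m - 2))
      ((2 * (m : ℝ) - 2) / (2 * (m : ℝ) - 1) * oddRoot m y ^ (2 * m - 2) / y) y := by
  have h := ((Real.hasDerivAt_log hy).const_mul
    ((2 * (m : ℝ) - 2) / (2 * (m : ℝ) - 1))).exp
  rw [← oddRoot_pow_eq_exp m hm hy] at h
  refine (h.congr_of_eventuallyEq ?_).congr_deriv (by ring)
  filter_upwards [eventually_ne_nhds hy] with x hx
  exact oddRoot_pow_eq_exp m hm hx

/-- no smooth function on a nonempty open interval with nowhere
vanishing `f'` and `f''` satisfies both (4.9) and (4.10) (the latter with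
constant `2c₀`); indeed these force `c₀ = 0` and hence `f'' ≡ 0`. -/
theorem no_solution_of_ode_pair (m : ℕ) (hm : 1 ≤ m) (c₀ : ℝ) :
    ¬ ∃ (a b : ℝ) (f : ℝ → ℝ), a < b ∧
      ContDiffOn ℝ (⊤ : ℕ∞) f (Set.Ioo a b) ∧
      (∀ t ∈ Set.Ioo a b, deriv f t ≠ 0) ∧
      (∀ t ∈ Set.Ioo a b, deriv (deriv f) t ≠ 0) ∧
      (∀ t ∈ Set.Ioo a b, deriv (deriv f) t
          = c₀ / (2 * (m : ℝ))
            * ((oddRoot m (deriv f t)) ^ (2 * m - 2) + 2 * (deriv f t) ^ 2)) ∧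
      (∀ t ∈ Set.Ioo a b, (2 * (m : ℝ) - 2) * deriv (deriv f) t / (deriv f t) ^ 2
          - (2 * (m : ℝ) - 1) * deriv (deriv (deriv f)) t
            / (deriv f t * deriv (deriv f) t) = 2 * c₀) := by
  rintro ⟨a, b, f, hab, -, hf1, hf2, hode, hratio⟩
  obtain ⟨t, ht⟩ := Set.nonempty_Ioo.mpr hab
  have hg := hf1 t ht
  have hg' := hf2 t ht
  have hd : HasDerivAt (deriv f) (deriv (deriv f) t) t :=
    (differentiableAt_of_deriv_ne_zero hg').hasDerivAt
  have hrhs := (((hasDerivAt_oddRoot_pow m hm hg).comp t hd).add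
    ((hd.pow 2).const_mul 2)).const_mul (c₀ / (2 * (m : ℝ)))
  have hthird := (hrhs.congr_of_eventuallyEq
    (Filter.eventually_of_mem (Ioo_mem_nhds ht.1 ht.2) hode)).deriv
  have hr := hratio t ht
  have ho := hode t ht
  rw [hthird] at hr
  generalize deriv (deriv f) t = w at *
  generalize deriv f t = g at *
  generalize oddRoot m g ^ (2 * m - 2) = p at *
  have hm' : (1 : ℝ) ≤ m := by exact_mod_cast hm
  have hm0 : (m : ℝ) ≠ 0 := by positivity
  have hk : 2 * (m : ℝ) - 1 ≠ 0 := by linarith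
  have hsimp : (2 * (m : ℝ) - 2) * w / g ^ 2 - (2 * (m : ℝ) - 1)
      * (c₀ / (2 * (m : ℝ)) * ((2 * (m : ℝ) - 2) / (2 * (m : ℝ) - 1) * p / g * w
        + 2 * (2 * g * w))) / (g * w) = -2 * c₀ := by
    have hcancel : (2 * (m : ℝ) - 1)
        * (c₀ / (2 * (m : ℝ)) * ((2 * (m : ℝ) - 2) / (2 * (m : ℝ) - 1) * p / g * w
          + 2 * (2 * g * w))) / (g * w)
        = c₀ / (2 * (m : ℝ)) * ((2 * (m : ℝ) - 2) * p / g ^ 2 + 4 * (2 * (m : ℝ) - 1)) := by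
      field_simp
      ring
    rw [hcancel, ho]
    field_simp
    ring
  norm_num at hr
  have hc : c₀ = 0 := by linarith
  exact hg' (by simp [ho, hc])
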